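/- Let g:ℝ²→ℝ be compactly supported and Lipschitz with respect to d̃. Define the double layer potential D(g)(x)=∫_{ℝ²} (k₁(x,ŷ)+k(x,ŷ)) g(ŷ) dŷ for x∈ℝ³ with x₁≠0, and for x̂₀∈ℝ² define K(g)(x̂₀)=∫_{B̂₁(x̂₀)} k(x̂₀−ŷ)(g(ŷ)−g(x̂₀)) dŷ + ∫_{ℝ²∖B̂₁(x̂₀)} k(x̂₀−ŷ) g(ŷ) dŷ (both integrals converge absolutely). Then for every x̂₀∈ℝ², lim_{x→(0,x̂₀), x₁>0} D(g)(x) = (1/2)g(x̂₀) + K(g)(x̂₀) and lim_{x→(0,x̂₀), x₁<0} D(g)(x) = −(1/2)g(x̂₀) + K(g)(x̂₀). -/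

import Mathlib

open MeasureTheory Filter

noncomputable section

/-- The quantity `D(x, ŷ)` from the double layer potential kernels. -/
def Dden (x : ℝ × ℝ × ℝ) (y : ℝ × ℝ) : ℝ :=
  (x.1 ^ 2 + (x.2.1 - y.1) ^ 2) ^ 2 + 16 * (x.2.2 - y.2 + (1 / 2) * y.1 * x.1) ^ 2

/-- The kernel `k₁(x, ŷ)`. -/
def k1 (c : ℝ) (x : ℝ × ℝ × ℝ) (y : ℝ × ℝ) : ℝ :=
  2 * c * (x.1 ^ 2 + (x.2.1 - y.1) ^ 2) * x.1 * Dden x y ^ (-(3 : ℝ) / 2)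

/-- The kernel `k(x, ŷ)`. -/
def kker (c : ℝ) (x : ℝ × ℝ × ℝ) (y : ℝ × ℝ) : ℝ :=
  8 * c * (x.2.1 - y.1) * (x.2.2 - y.2 + (1 / 2) * y.1 * x.1) * Dden x y ^ (-(3 : ℝ) / 2)

/-- The homogeneous distance `d̃` on the vertical plane `Π ≅ ℝ²`. -/
def dt (a b : ℝ × ℝ) : ℝ := ((a.1 - b.1) ^ 4 + 16 * (a.2 - b.2) ^ 2) ^ ((1 : ℝ) / 4)

/-- The ball of `d̃` of radius `r` centered at `a`. -/
def bhat (r : ℝ) (a : ℝ × ℝ) : Set (ℝ × ℝ) := {b | dt a b < r}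

/-- The candidate fundamental solution `Γ_c(x, y)` on the first Heisenberg group. -/
def Gam (c : ℝ) (x y : ℝ × ℝ × ℝ) : ℝ :=
  c * (((x.1 - y.1) ^ 2 + (x.2.1 - y.2.1) ^ 2) ^ 2 +
    16 * (x.2.2 - y.2.2 - (1 / 2) * (y.1 * x.2.1 - y.2.1 * x.1)) ^ 2) ^ (-(1 : ℝ) / 2)

/-- Derivative along the left-invariant vector field `X₁ = ∂₁ - (x₂/2) ∂₃`. -/
def X1d (f : ℝ × ℝ × ℝ → ℝ) (x : ℝ × ℝ × ℝ) : ℝ :=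
  fderiv ℝ f x ((1 : ℝ), (0 : ℝ), -(x.2.1 / 2))

/-- Derivative along the left-invariant vector field `X₂ = ∂₂ + (x₁/2) ∂₃`. -/
def X2d (f : ℝ × ℝ × ℝ → ℝ) (x : ℝ × ℝ × ℝ) : ℝ :=
  fderiv ℝ f x ((0 : ℝ), (1 : ℝ), x.1 / 2)

/-- The sub-Laplacian `Δ_ℍ = X₁² + X₂²`. -/
def subLap (f : ℝ × ℝ × ℝ → ℝ) (x : ℝ × ℝ × ℝ) : ℝ :=
  X1d (X1d f) x + X2d (X2d f) x

/-- `c` is the normalizing constant making `Γ_c` the fundamental solution of `Δ_ℍ`. -/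
def IsNormalizing (c : ℝ) : Prop :=
  ∀ φ : ℝ × ℝ × ℝ → ℝ, ContDiff ℝ (⊤ : ℕ∞) φ → HasCompactSupport φ →
    ∫ y, Gam c 0 y * subLap φ y = -φ 0

/-- The boundary convolution kernel `k(v̂) = 8c v₂ v₃ (v₂⁴ + 16 v₃²)^{-3/2}` on `Π`. -/
def kconv (c : ℝ) (v : ℝ × ℝ) : ℝ :=
  8 * c * v.1 * v.2 * (v.1 ^ 4 + 16 * v.2 ^ 2) ^ (-(3 : ℝ) / 2)

lemma continuous_of_abs_sub_le_dt {g : ℝ × ℝ → ℝ} {L : ℝ}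
    (hLip : ∀ a b : ℝ × ℝ, |g a - g b| ≤ L * dt a b) : Continuous g := by
  rw [continuous_iff_continuousAt]
  intro a
  rw [ContinuousAt, tendsto_iff_norm_sub_tendsto_zero]
  have h : Tendsto (fun b => L * dt b a) (nhds a) (nhds (L * dt a a)) := by
    apply Continuous.tendsto
    unfold dt
    refine continuous_const.mul (Continuous.rpow_const (by fun_prop) ?_)
    intro x; right; norm_num
  have h0 : L * dt a a = 0 := by simp [dt]
  rw [h0] at h
  exact squeeze_zero (fun b => norm_nonneg _) (fun b => hLip b a) h

/-- The kernel `kker` at height `e`, in sheared coordinates centred at the projected pole. -/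
def kShear (c e : ℝ) (w : ℝ × ℝ) : ℝ :=
  8 * c * w.1 * w.2 * ((e ^ 2 + w.1 ^ 2) ^ 2 + 16 * w.2 ^ 2) ^ (-(3 : ℝ) / 2)

/-- The shear of the plane that centres the kernels at the projection of `x`. -/
def shear (x : ℝ × ℝ × ℝ) (w : ℝ × ℝ) : ℝ × ℝ :=
  (x.2.1 - w.1, x.2.2 + (1 / 2) * (x.2.1 - w.1) * x.1 - w.2)

lemma kShear_zero (c : ℝ) : kShear c 0 = kconv c := by
  ext w
  simp only [kShear, kconv]
  congr 2
  ring

lemma kker_shear (c : ℝ) (x : ℝ × ℝ × ℝ) (w : ℝ × ℝ) :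
    kker c x (shear x w) = kShear c x.1 w := by
  have h1 : x.2.1 - (shear x w).1 = w.1 := by simp [shear]
  have h2 : x.2.2 - (shear x w).2 + (1 / 2) * (shear x w).1 * x.1 = w.2 := by
    simp only [shear]; ring
  simp only [kker, Dden, h1, h2, kShear]

lemma k1_shear (c : ℝ) (x : ℝ × ℝ × ℝ) (w : ℝ × ℝ) :
    k1 c x (shear x w) =
      2 * c * (x.1 ^ 2 + w.1 ^ 2) * x.1 *
        ((x.1 ^ 2 + w.1 ^ 2) ^ 2 + 16 * w.2 ^ 2) ^ (-(3 : ℝ) / 2) := by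
  have h1 : x.2.1 - (shear x w).1 = w.1 := by simp [shear]
  have h2 : x.2.2 - (shear x w).2 + (1 / 2) * (shear x w).1 * x.1 = w.2 := by
    simp only [shear]; ring
  simp only [k1, Dden, h1, h2]

lemma measurePreserving_shear (x : ℝ × ℝ × ℝ) : MeasurePreserving (shear x) := by
  have h := MeasurePreserving.skew_product (μa := (volume : Measure ℝ)) (μb := (volume : Measure ℝ))
    (μc := (volume : Measure ℝ)) (μd := (volume : Measure ℝ))
    (f := fun u => x.2.1 - u) (Measure.measurePreserving_sub_left volume x.2.1)
    (g := fun u v => x.2.2 + (1 / 2) * (x.2.1 - u) * x.1 - v) (by fun_prop)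
    (Eventually.of_forall fun u => (Measure.measurePreserving_sub_left volume _).map_eq)
  exact h

lemma integral_comp_shear (x : ℝ × ℝ × ℝ) {F : ℝ × ℝ → ℝ} (hF : Continuous F) :
    ∫ w, F (shear x w) = ∫ y, F y := by
  have h := measurePreserving_shear x
  rw [← integral_map h.measurable.aemeasurable hF.aestronglyMeasurable, h.map_eq]

lemma Dden_pos {x : ℝ × ℝ × ℝ} (hx : x.1 ≠ 0) (y : ℝ × ℝ) : 0 < Dden x y := by
  have : 0 < x.1 ^ 2 := by positivity
  unfold Dden; positivity

lemma continuous_Dden_rpow {x : ℝ × ℝ × ℝ} (hx : x.1 ≠ 0) :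
    Continuous fun y => Dden x y ^ (-(3 : ℝ) / 2) := by
  refine Continuous.rpow_const (by unfold Dden; fun_prop) ?_
  intro y; left; exact (Dden_pos hx y).ne'

lemma continuous_k1 (c : ℝ) {x : ℝ × ℝ × ℝ} (hx : x.1 ≠ 0) : Continuous (k1 c x) := by
  have := continuous_Dden_rpow hx
  unfold k1; fun_prop

lemma continuous_kker (c : ℝ) {x : ℝ × ℝ × ℝ} (hx : x.1 ≠ 0) : Continuous (kker c x) := by
  have := continuous_Dden_rpow hx
  unfold kker; fun_prop

lemma continuous_kShear (c : ℝ) {e : ℝ} (he : e ≠ 0) : Continuous (kShear c e) := by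
  have h : Continuous fun w : ℝ × ℝ =>
      ((e ^ 2 + w.1 ^ 2) ^ 2 + 16 * w.2 ^ 2) ^ (-(3 : ℝ) / 2) := by
    refine Continuous.rpow_const (by fun_prop) ?_
    intro y; left; positivity
  unfold kShear; fun_prop

/-- The centred unit ball of the homogeneous distance. -/
def unitBall : Set (ℝ × ℝ) := {w | w.1 ^ 4 + 16 * w.2 ^ 2 < 1}

lemma measurableSet_unitBall : MeasurableSet unitBall :=
  measurableSet_lt (by fun_prop) (by fun_prop)

lemma mem_bhat_one_iff (a w : ℝ × ℝ) : w ∈ bhat 1 a ↔ a - w ∈ unitBall := by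
  simp only [bhat, unitBall, dt, Set.mem_ofPred_eq, Prod.fst_sub, Prod.snd_sub]
  rw [Real.rpow_lt_one_iff' (by positivity) (by norm_num)]

lemma abs_le_one_of_mem_unitBall {w : ℝ × ℝ} (hw : w ∈ unitBall) : |w.1| ≤ 1 ∧ |w.2| ≤ 1 := by
  simp only [unitBall, Set.mem_ofPred_eq] at hw
  constructor
  · rw [abs_le_one_iff_mul_self_le_one]
    nlinarith [sq_nonneg w.2, sq_nonneg (w.1 ^ 2 - 1)]
  · rw [abs_le_one_iff_mul_self_le_one]
    nlinarith [sq_nonneg w.2, sq_nonneg (w.1 ^ 2)]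

lemma measurable_kShear (c e : ℝ) : Measurable (kShear c e) := by
  unfold kShear; fun_prop

lemma abs_kShear {c : ℝ} (hc : 0 ≤ c) (e : ℝ) (w : ℝ × ℝ) :
    |kShear c e w| =
      8 * c * |w.1| * |w.2| * ((e ^ 2 + w.1 ^ 2) ^ 2 + 16 * w.2 ^ 2) ^ (-(3 : ℝ) / 2) := by
  have h : 0 ≤ ((e ^ 2 + w.1 ^ 2) ^ 2 + 16 * w.2 ^ 2) ^ (-(3 : ℝ) / 2) := by positivity
  simp only [kShear, abs_mul, abs_of_nonneg hc, abs_of_nonneg h]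
  norm_num

lemma abs_kShear_mul_rpow_le {c : ℝ} (hc : 0 ≤ c) (e : ℝ) (w : ℝ × ℝ) :
    |kShear c e w| * ((e ^ 2 + w.1 ^ 2) ^ 2 + 16 * w.2 ^ 2) ^ ((1 : ℝ) / 4) ≤
      8 * c * (|w.1| ^ (-(1 : ℝ) / 2) * |w.2| ^ (-(3 : ℝ) / 4)) := by
  rw [abs_kShear hc]
  rcases eq_or_ne w.1 0 with h1 | h1
  · simp only [h1, abs_zero, mul_zero, zero_mul]; positivity
  rcases eq_or_ne w.2 0 with h2 | h2
  · simp only [h2, abs_zero, mul_zero, zero_mul]; positivity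
  have ha : 0 < |w.1| := abs_pos.mpr h1
  have hb : 0 < |w.2| := abs_pos.mpr h2
  have hEa : |w.1| ^ 4 ≤ (e ^ 2 + w.1 ^ 2) ^ 2 + 16 * w.2 ^ 2 := by
    have : |w.1| ^ 4 = (w.1 ^ 2) ^ 2 := by rw [← sq_abs w.1]; ring
    rw [this]
    nlinarith [sq_nonneg e, sq_nonneg w.1, sq_nonneg w.2, mul_nonneg (sq_nonneg e) (sq_nonneg w.1),
      sq_nonneg (e ^ 2)]
  have hEb : |w.2| ^ 2 ≤ (e ^ 2 + w.1 ^ 2) ^ 2 + 16 * w.2 ^ 2 := by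
    rw [sq_abs]
    nlinarith [sq_nonneg w.2, sq_nonneg (e ^ 2 + w.1 ^ 2)]
  set a := |w.1|
  set b := |w.2|
  set E := (e ^ 2 + w.1 ^ 2) ^ 2 + 16 * w.2 ^ 2
  have hE : 0 < E := lt_of_lt_of_le (by positivity) hEa
  have e1 : E ^ (-(3 : ℝ) / 2) * E ^ ((1 : ℝ) / 4) = E ^ (-(3 : ℝ) / 8) * E ^ (-(7 : ℝ) / 8) := by
    rw [← Real.rpow_add hE, ← Real.rpow_add hE]; norm_num
  have e2 : E ^ (-(3 : ℝ) / 8) ≤ a ^ (-(3 : ℝ) / 2) := by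
    refine (Real.rpow_le_rpow_of_nonpos (by positivity) hEa (by norm_num)).trans_eq ?_
    rw [← Real.rpow_natCast, ← Real.rpow_mul ha.le]; norm_num
  have e3 : E ^ (-(7 : ℝ) / 8) ≤ b ^ (-(7 : ℝ) / 4) := by
    refine (Real.rpow_le_rpow_of_nonpos (by positivity) hEb (by norm_num)).trans_eq ?_
    rw [← Real.rpow_natCast, ← Real.rpow_mul hb.le]; norm_num
  have e4 : a * a ^ (-(3 : ℝ) / 2) = a ^ (-(1 : ℝ) / 2) := by
    nth_rewrite 1 [← Real.rpow_one a]
    rw [← Real.rpow_add ha]; norm_num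
  have e5 : b * b ^ (-(7 : ℝ) / 4) = b ^ (-(3 : ℝ) / 4) := by
    nth_rewrite 1 [← Real.rpow_one b]
    rw [← Real.rpow_add hb]; norm_num
  calc 8 * c * a * b * E ^ (-(3 : ℝ) / 2) * E ^ ((1 : ℝ) / 4)
      = 8 * c * a * b * (E ^ (-(3 : ℝ) / 8) * E ^ (-(7 : ℝ) / 8)) := by rw [← e1]; ring
    _ ≤ 8 * c * a * b * (a ^ (-(3 : ℝ) / 2) * b ^ (-(7 : ℝ) / 4)) := by gcongr
    _ = 8 * c * (a ^ (-(1 : ℝ) / 2) * b ^ (-(3 : ℝ) / 4)) := by rw [← e4, ← e5]; ring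

lemma integrableOn_abs_rpow {r : ℝ} (hr : -1 < r) :
    IntegrableOn (fun u : ℝ => |u| ^ r) (Set.Icc (-1) 1) := by
  have h1 : IntervalIntegrable (fun u : ℝ => |u| ^ r) volume 0 1 := by
    refine (intervalIntegral.intervalIntegrable_rpow' hr).congr ?_
    intro u hu
    rw [Set.uIoc_of_le zero_le_one] at hu
    simp only [abs_of_pos hu.1]
  have h2 : IntervalIntegrable (fun u : ℝ => |u| ^ r) volume (-1) 0 := by
    have := (IntervalIntegrable.iff_comp_neg (f := fun u : ℝ => |u| ^ r)).mp h1
    simpa using this.symm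
  rw [integrableOn_Icc_iff_integrableOn_Ioc,
    ← intervalIntegrable_iff_integrableOn_Ioc_of_le (by norm_num)]
  exact h2.trans h1

/-- The weak singularity that dominates the kernel times the homogeneous distance,
truncated to the unit box. -/
def singBound (w : ℝ × ℝ) : ℝ :=
  (Set.Icc (-1 : ℝ) 1).indicator (fun u => |u| ^ (-(1 : ℝ) / 2)) w.1 *
    (Set.Icc (-1 : ℝ) 1).indicator (fun v => |v| ^ (-(3 : ℝ) / 4)) w.2

lemma integrable_singBound : Integrable singBound :=
  Integrable.mul_prod
    ((integrableOn_abs_rpow (by norm_num)).integrable_indicator measurableSet_Icc)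
    ((integrableOn_abs_rpow (by norm_num)).integrable_indicator measurableSet_Icc)

lemma singBound_nonneg (w : ℝ × ℝ) : 0 ≤ singBound w :=
  mul_nonneg (Set.indicator_nonneg (fun _ _ => by positivity) _)
    (Set.indicator_nonneg (fun _ _ => by positivity) _)

lemma singBound_of_mem_unitBall {w : ℝ × ℝ} (hw : w ∈ unitBall) :
    singBound w = |w.1| ^ (-(1 : ℝ) / 2) * |w.2| ^ (-(3 : ℝ) / 4) := by
  obtain ⟨h1, h2⟩ := abs_le_one_of_mem_unitBall hw
  rw [singBound, Set.indicator_of_mem (Set.mem_Icc.mpr (abs_le.mp h1)),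
    Set.indicator_of_mem (Set.mem_Icc.mpr (abs_le.mp h2))]

lemma dt_shear_le (x : ℝ × ℝ × ℝ) (w : ℝ × ℝ) :
    dt (shear x w) (shear x 0) ≤
      3 * ((x.1 ^ 2 + w.1 ^ 2) ^ 2 + 16 * w.2 ^ 2) ^ ((1 : ℝ) / 4) := by
  have h3 : (3 : ℝ) = (81 : ℝ) ^ ((1 : ℝ) / 4) := by
    rw [show (81 : ℝ) = 3 ^ (4 : ℝ) by norm_num, ← Real.rpow_mul (by norm_num)]; norm_num
  rw [h3, ← Real.mul_rpow (by norm_num) (by positivity)]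
  unfold dt
  refine Real.rpow_le_rpow (by positivity) ?_ (by norm_num)
  simp only [shear, Prod.fst_zero, Prod.snd_zero]
  have e1 : (x.2.1 - w.1 - (x.2.1 - 0)) ^ 4 = w.1 ^ 4 := by ring
  have e2 : (x.2.2 + 1 / 2 * (x.2.1 - w.1) * x.1 - w.2 -
      (x.2.2 + 1 / 2 * (x.2.1 - 0) * x.1 - 0)) ^ 2 = (w.1 * x.1 / 2 + w.2) ^ 2 := by ring
  rw [e1, e2]
  nlinarith [sq_nonneg (w.1 * x.1 / 2 - w.2), sq_nonneg w.2, sq_nonneg (w.1 ^ 2),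
    sq_nonneg (x.1 ^ 2), mul_nonneg (sq_nonneg w.1) (sq_nonneg x.1)]

/-- The kernel tested against `g`, with the value at the centre subtracted on the unit ball. -/
def regIntegrand (c : ℝ) (g : ℝ × ℝ → ℝ) (x : ℝ × ℝ × ℝ) (w : ℝ × ℝ) : ℝ :=
  kShear c x.1 w * (g (shear x w) - unitBall.indicator (fun _ => g (shear x 0)) w)

lemma measurable_regIntegrand (c : ℝ) {g : ℝ × ℝ → ℝ} (hg : Continuous g) (x : ℝ × ℝ × ℝ) :
    Measurable (regIntegrand c g x) :=
  (measurable_kShear c x.1).mul ((hg.measurable.comp (measurePreserving_shear x).measurable).sub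
    (measurable_const.indicator measurableSet_unitBall))

lemma abs_kShear_le_of_notMem {c : ℝ} (hc : 0 ≤ c) (e : ℝ) {w : ℝ × ℝ} (hw : w ∉ unitBall) :
    |kShear c e w| ≤ 8 * c * |w.1| * |w.2| := by
  rw [abs_kShear hc]
  refine mul_le_of_le_one_right (by positivity) ?_
  refine Real.rpow_le_one_of_one_le_of_nonpos ?_ (by norm_num)
  simp only [unitBall, Set.mem_ofPred_eq, not_lt] at hw
  nlinarith [mul_nonneg (sq_nonneg e) (sq_nonneg w.1), sq_nonneg (e ^ 2)]

lemma exists_bound_of_hasCompactSupport {g : ℝ × ℝ → ℝ} (hg : HasCompactSupport g) :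
    ∃ R, 0 ≤ R ∧ ∀ y, g y ≠ 0 → |y.1| ≤ R ∧ |y.2| ≤ R := by
  obtain ⟨R, hR⟩ := hg.isBounded.exists_norm_le
  refine ⟨max R 0, le_max_right _ _, fun y hy => ?_⟩
  have h := (hR y (subset_tsupport g hy)).trans (le_max_left R 0)
  rw [Prod.norm_def] at h
  exact ⟨(le_max_left _ _).trans h, (le_max_right _ _).trans h⟩

lemma exists_shear_bound {g : ℝ × ℝ → ℝ} (hg : HasCompactSupport g) (x0 : ℝ × ℝ) :
    ∃ R, 0 ≤ R ∧ ∀ᶠ x in nhds ((0 : ℝ), x0.1, x0.2), ∀ w,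
      g (shear x w) ≠ 0 → |w.1| ≤ R ∧ |w.2| ≤ R := by
  obtain ⟨R, hR0, hR⟩ := exists_bound_of_hasCompactSupport hg
  refine ⟨2 * R + |x0.1| + |x0.2| + 2, by positivity, ?_⟩
  filter_upwards [Metric.ball_mem_nhds _ one_pos] with x hx w hw
  rw [Metric.mem_ball, Prod.dist_eq, Prod.dist_eq] at hx
  simp only [max_lt_iff, Real.dist_eq, sub_zero] at hx
  obtain ⟨hx1, hx2, hx3⟩ := hx
  obtain ⟨h1, h2⟩ := hR _ hw
  have e1 : w.1 = (x.2.1 - x0.1) + x0.1 - (shear x w).1 := by simp only [shear]; ring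
  have e2 : w.2 = (x.2.2 - x0.2) + x0.2 + 1 / 2 * ((shear x w).1 * x.1) - (shear x w).2 := by
    simp only [shear]; ring
  have hp : |(shear x w).1 * x.1| ≤ R := by
    rw [abs_mul]
    calc _ ≤ R * 1 := by gcongr
      _ = R := mul_one R
  have := abs_nonneg x0.1
  have := abs_nonneg x0.2
  rw [abs_lt] at hx1 hx2 hx3
  rw [abs_le] at h1 h2 hp
  have := abs_le.mp (le_refl |x0.1|)
  have := abs_le.mp (le_refl |x0.2|)
  constructor
  · rw [abs_le]; constructor <;> linarith
  · rw [abs_le]; constructor <;> linarith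

lemma exists_regIntegrand_bound {c : ℝ} (hc : 0 ≤ c) {g : ℝ × ℝ → ℝ} (hg : HasCompactSupport g)
    {L : ℝ} (hLip : ∀ a b : ℝ × ℝ, |g a - g b| ≤ L * dt a b) (x0 : ℝ × ℝ) :
    ∃ F : ℝ × ℝ → ℝ, Integrable F ∧ ∀ᶠ x in nhds ((0 : ℝ), x0.1, x0.2), ∀ w,
      ‖regIntegrand c g x w‖ ≤ F w := by
  have hgc := continuous_of_abs_sub_le_dt hLip
  obtain ⟨M, hM⟩ := hg.exists_bound_of_continuous hgc
  have hM0 : 0 ≤ M := (norm_nonneg _).trans (hM 0)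
  obtain ⟨R, hR0, hR⟩ := exists_shear_bound hg x0
  refine ⟨fun w => 24 * c * |L| * singBound w +
    (Set.Icc (-R) R ×ˢ Set.Icc (-R) R).indicator (fun _ => 8 * c * R * R * M) w, ?_, ?_⟩
  · refine (integrable_singBound.const_mul _).add ?_
    refine (integrable_indicator_iff (measurableSet_Icc.prod measurableSet_Icc)).mpr ?_
    exact integrableOn_const ((isCompact_Icc.prod isCompact_Icc).measure_lt_top.ne)
  · filter_upwards [hR] with x hx w
    rw [Real.norm_eq_abs, regIntegrand, abs_mul]
    by_cases hw : w ∈ unitBall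
    · rw [Set.indicator_of_mem hw]
      refine le_add_of_le_of_nonneg ?_ (Set.indicator_nonneg (fun _ _ => by positivity) _)
      have hd := abs_kShear_mul_rpow_le hc x.1 w
      rw [← singBound_of_mem_unitBall hw] at hd
      calc |kShear c x.1 w| * |g (shear x w) - g (shear x 0)|
          ≤ |kShear c x.1 w| *
            (|L| * (3 * ((x.1 ^ 2 + w.1 ^ 2) ^ 2 + 16 * w.2 ^ 2) ^ ((1 : ℝ) / 4))) := by
            gcongr
            refine (hLip _ _).trans ?_
            have : 0 ≤ dt (shear x w) (shear x 0) := by unfold dt; positivity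
            calc _ ≤ |L| * dt (shear x w) (shear x 0) := by gcongr; exact le_abs_self L
              _ ≤ _ := by gcongr; exact dt_shear_le x w
        _ = 3 * |L| * (|kShear c x.1 w| *
            ((x.1 ^ 2 + w.1 ^ 2) ^ 2 + 16 * w.2 ^ 2) ^ ((1 : ℝ) / 4)) := by ring
        _ ≤ 3 * |L| * (8 * c * singBound w) := by gcongr
        _ = _ := by ring
    · rw [Set.indicator_of_notMem hw, sub_zero]
      refine le_add_of_nonneg_of_le
        (mul_nonneg (by positivity) (singBound_nonneg w)) ?_
      by_cases h0 : g (shear x w) = 0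
      · rw [h0, abs_zero, mul_zero]
        exact Set.indicator_nonneg (fun _ _ => by positivity) _
      · obtain ⟨h1, h2⟩ := hx w h0
        rw [Set.indicator_of_mem (Set.mem_prod.mpr ⟨abs_le.mp h1, abs_le.mp h2⟩)]
        have := abs_kShear_le_of_notMem hc x.1 hw
        calc |kShear c x.1 w| * |g (shear x w)| ≤ (8 * c * |w.1| * |w.2|) * M := by
              gcongr; exact hM _
          _ ≤ _ := by gcongr

lemma integral_kShear_unitBall (c e : ℝ) : ∫ w, unitBall.indicator (kShear c e) w = 0 := by
  have h : MeasurePreserving (Prod.map id Neg.neg : ℝ × ℝ → ℝ × ℝ) :=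
    (MeasurePreserving.id volume).prod (Measure.measurePreserving_neg volume)
  have he : MeasurableEmbedding (Prod.map id Neg.neg : ℝ × ℝ → ℝ × ℝ) :=
    MeasurableEmbedding.id.prodMap (MeasurableEquiv.neg ℝ).measurableEmbedding
  have h1 := h.integral_comp he (unitBall.indicator (kShear c e))
  have h2 : ∀ w : ℝ × ℝ, unitBall.indicator (kShear c e) (Prod.map id Neg.neg w) =
      -unitBall.indicator (kShear c e) w := by
    intro w
    by_cases hw : w ∈ unitBall
    · have hw' : Prod.map id Neg.neg w ∈ unitBall := by
        simpa [unitBall] using hw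
      rw [Set.indicator_of_mem hw, Set.indicator_of_mem hw']
      simp [kShear]
    · have hw' : Prod.map id Neg.neg w ∉ unitBall := by
        simpa [unitBall] using hw
      rw [Set.indicator_of_notMem hw, Set.indicator_of_notMem hw', neg_zero]
  simp only [h2, integral_neg] at h1
  linarith

lemma integral_kker_mul (c : ℝ) {g : ℝ × ℝ → ℝ} (hg : HasCompactSupport g) (hgc : Continuous g)
    {x : ℝ × ℝ × ℝ} (hx : x.1 ≠ 0) :
    ∫ y, kker c x y * g y = ∫ w, regIntegrand c g x w := by
  have hcont : Continuous fun y => kker c x y * g y := (continuous_kker c hx).mul hgc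
  rw [← integral_comp_shear x hcont]
  have hi1 : Integrable fun w => kker c x (shear x w) * g (shear x w) :=
    (measurePreserving_shear x).integrable_comp_of_integrable
      (hcont.integrable_of_hasCompactSupport hg.mul_left)
  have hi2 : Integrable (unitBall.indicator (kShear c x.1)) := by
    rw [integrable_indicator_iff measurableSet_unitBall]
    refine ((continuous_kShear c hx).continuousOn.integrableOn_compact
      (isCompact_Icc.prod isCompact_Icc)).mono_set
      (t := Set.Icc (-1 : ℝ) 1 ×ˢ Set.Icc (-1 : ℝ) 1) ?_
    intro w hw
    obtain ⟨h1, h2⟩ := abs_le_one_of_mem_unitBall hw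
    exact ⟨abs_le.mp h1, abs_le.mp h2⟩
  have e : ∀ w, regIntegrand c g x w = kker c x (shear x w) * g (shear x w) -
      unitBall.indicator (kShear c x.1) w * g (shear x 0) := by
    intro w
    rw [regIntegrand, kker_shear, mul_sub]
    by_cases hw : w ∈ unitBall
    · simp only [Set.indicator_of_mem hw]
    · simp only [Set.indicator_of_notMem hw, mul_zero, zero_mul]
  simp only [e]
  rw [integral_sub hi1 (hi2.mul_const _), integral_mul_const, integral_kShear_unitBall]
  simp

lemma tendsto_regIntegrand {c : ℝ} {g : ℝ × ℝ → ℝ} (hgc : Continuous g) (x0 : ℝ × ℝ)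
    {w : ℝ × ℝ} (hw : w ≠ 0) :
    Tendsto (fun x => regIntegrand c g x w) (nhds ((0 : ℝ), x0.1, x0.2))
      (nhds (regIntegrand c g ((0 : ℝ), x0.1, x0.2) w)) := by
  have hk : ContinuousAt (fun x : ℝ × ℝ × ℝ => kShear c x.1 w) ((0 : ℝ), x0.1, x0.2) := by
    unfold kShear
    refine continuousAt_const.mul (ContinuousAt.rpow_const (by fun_prop) ?_)
    left
    have : w.1 ≠ 0 ∨ w.2 ≠ 0 := by
      by_contra! h
      exact hw (Prod.ext h.1 h.2)
    rcases this with h | h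
    · positivity
    · positivity
  have hs : ∀ v, ContinuousAt (fun x : ℝ × ℝ × ℝ => g (shear x v)) ((0 : ℝ), x0.1, x0.2) := by
    intro v
    refine (hgc.comp ?_).continuousAt
    unfold shear; fun_prop
  refine hk.mul ((hs w).sub ?_)
  by_cases h : w ∈ unitBall
  · simp only [Set.indicator_of_mem h]; exact hs 0
  · simp only [Set.indicator_of_notMem h]; exact continuousAt_const

lemma tendsto_integral_kker {c : ℝ} (hc : 0 ≤ c) {g : ℝ × ℝ → ℝ} (hg : HasCompactSupport g)
    {L : ℝ} (hLip : ∀ a b : ℝ × ℝ, |g a - g b| ≤ L * dt a b) (x0 : ℝ × ℝ) :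
    Tendsto (fun x => ∫ y, kker c x y * g y)
      (nhdsWithin ((0 : ℝ), x0.1, x0.2) {x : ℝ × ℝ × ℝ | x.1 ≠ 0})
      (nhds (∫ w, regIntegrand c g ((0 : ℝ), x0.1, x0.2) w)) := by
  have hgc := continuous_of_abs_sub_le_dt hLip
  obtain ⟨F, hF, hb⟩ := exists_regIntegrand_bound hc hg hLip x0
  have h : Tendsto (fun x => ∫ w, regIntegrand c g x w) (nhds ((0 : ℝ), x0.1, x0.2))
      (nhds (∫ w, regIntegrand c g ((0 : ℝ), x0.1, x0.2) w)) := by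
    refine tendsto_integral_filter_of_dominated_convergence F ?_ ?_ hF ?_
    · exact Eventually.of_forall fun x => (measurable_regIntegrand c hgc x).aestronglyMeasurable
    · exact hb.mono fun x hx => Eventually.of_forall hx
    · filter_upwards [compl_mem_ae_iff.mpr (measure_singleton (0 : ℝ × ℝ))] with w hw
      exact tendsto_regIntegrand hgc x0 hw
  refine (h.mono_left nhdsWithin_le_nhds).congr' ?_
  filter_upwards [self_mem_nhdsWithin] with x hx
  exact (integral_kker_mul c hg hgc hx).symm

lemma integrable_regIntegrand {c : ℝ} (hc : 0 ≤ c) {g : ℝ × ℝ → ℝ} (hg : HasCompactSupport g)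
    {L : ℝ} (hLip : ∀ a b : ℝ × ℝ, |g a - g b| ≤ L * dt a b) (x0 : ℝ × ℝ) :
    Integrable (regIntegrand c g ((0 : ℝ), x0.1, x0.2)) := by
  obtain ⟨F, hF, hb⟩ := exists_regIntegrand_bound hc hg hLip x0
  exact hF.mono' (measurable_regIntegrand c (continuous_of_abs_sub_le_dt hLip) _).aestronglyMeasurable
    (Eventually.of_forall hb.self_of_nhds)

lemma regIntegrand_boundary (c : ℝ) (g : ℝ × ℝ → ℝ) (x0 y : ℝ × ℝ) :
    regIntegrand c g ((0 : ℝ), x0.1, x0.2) (x0 - y) =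
      kconv c (x0 - y) * (g y - (bhat 1 x0).indicator (fun _ => g x0) y) := by
  have h1 : shear ((0 : ℝ), x0.1, x0.2) (x0 - y) = y := by
    ext <;> simp [shear]
  have h2 : shear ((0 : ℝ), x0.1, x0.2) 0 = x0 := by
    ext <;> simp [shear]
  rw [regIntegrand, h1, h2, kShear_zero]
  by_cases h : y ∈ bhat 1 x0
  · rw [Set.indicator_of_mem h, Set.indicator_of_mem ((mem_bhat_one_iff _ _).mp h)]
  · rw [Set.indicator_of_notMem h, Set.indicator_of_notMem (mt (mem_bhat_one_iff _ _).mpr h)]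

lemma measurableSet_bhat_one (a : ℝ × ℝ) : MeasurableSet (bhat 1 a) := by
  unfold bhat dt
  exact measurableSet_lt (by fun_prop) (by fun_prop)

lemma kconv_integrals {c : ℝ} (hc : 0 ≤ c) {g : ℝ × ℝ → ℝ} (hg : HasCompactSupport g)
    {L : ℝ} (hLip : ∀ a b : ℝ × ℝ, |g a - g b| ≤ L * dt a b) (x0 : ℝ × ℝ) :
    IntegrableOn (fun y => kconv c (x0 - y) * (g y - g x0)) (bhat 1 x0) ∧
    IntegrableOn (fun y => kconv c (x0 - y) * g y) (bhat 1 x0)ᶜ ∧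
    (∫ y in bhat 1 x0, kconv c (x0 - y) * (g y - g x0)) +
      ∫ y in (bhat 1 x0)ᶜ, kconv c (x0 - y) * g y =
      ∫ w, regIntegrand c g ((0 : ℝ), x0.1, x0.2) w := by
  have hi := (integrable_regIntegrand hc hg hLip x0).comp_sub_left x0
  have hm := measurableSet_bhat_one x0
  have e1 : Set.EqOn (fun y => regIntegrand c g ((0 : ℝ), x0.1, x0.2) (x0 - y))
      (fun y => kconv c (x0 - y) * (g y - g x0)) (bhat 1 x0) := by
    intro y hy
    simp only [regIntegrand_boundary, Set.indicator_of_mem hy]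
  have e2 : Set.EqOn (fun y => regIntegrand c g ((0 : ℝ), x0.1, x0.2) (x0 - y))
      (fun y => kconv c (x0 - y) * g y) (bhat 1 x0)ᶜ := by
    intro y hy
    simp only [regIntegrand_boundary, Set.indicator_of_notMem hy, sub_zero]
  refine ⟨hi.integrableOn.congr_fun e1 hm, hi.integrableOn.congr_fun e2 hm.compl, ?_⟩
  rw [← setIntegral_congr_fun hm e1, ← setIntegral_congr_fun hm.compl e2,
    integral_add_compl hm hi, integral_sub_left_eq_self (regIntegrand c g _) volume x0]

lemma integrable_one_add_sq_rpow : Integrable fun v : ℝ => (1 + v ^ 2) ^ (-(3 : ℝ) / 2) := by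
  have h := integrable_rpow_neg_one_add_norm_sq (E := ℝ) (μ := volume) (r := 3) (by simp)
  simpa using h

lemma integral_one_add_sq_rpow : ∫ v : ℝ, (1 + v ^ 2) ^ (-(3 : ℝ) / 2) = 2 := by
  have hd : ∀ v : ℝ, HasDerivAt (fun v => Real.sin (Real.arctan v))
      ((1 + v ^ 2) ^ (-(3 : ℝ) / 2)) v := by
    intro v
    refine ((Real.hasDerivAt_arctan v).sin).congr_deriv ?_
    have hp : 0 < 1 + v ^ 2 := by positivity
    rw [Real.cos_arctan, Real.sqrt_eq_rpow]
    simp only [one_div]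
    rw [← Real.rpow_neg hp.le, ← Real.rpow_neg_one (1 + v ^ 2), ← Real.rpow_add hp]
    norm_num
  have ht : Tendsto (fun v => Real.sin (Real.arctan v)) atTop (nhds 1) := by
    rw [← Real.sin_pi_div_two]
    exact (Real.continuous_sin.tendsto _).comp
      (Real.tendsto_arctan_atTop.mono_right nhdsWithin_le_nhds)
  have hb : Tendsto (fun v => Real.sin (Real.arctan v)) atBot (nhds (-1)) := by
    rw [← Real.sin_pi_div_two, ← Real.sin_neg]
    exact (Real.continuous_sin.tendsto _).comp
      (Real.tendsto_arctan_atBot.mono_right nhdsWithin_le_nhds)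
  rw [integral_of_hasDerivAt_of_tendsto hd integrable_one_add_sq_rpow hb ht]
  norm_num

/-- The normalised profile of the kernel `k1` at unit height. -/
def profile (w : ℝ × ℝ) : ℝ :=
  (1 + w.1 ^ 2) * ((1 + w.1 ^ 2) ^ 2 + 16 * w.2 ^ 2) ^ (-(3 : ℝ) / 2)

lemma profile_nonneg (w : ℝ × ℝ) : 0 ≤ profile w := by unfold profile; positivity

lemma profile_eq (u v : ℝ) :
    profile (u, v) = ((1 + u ^ 2) ^ 2)⁻¹ * (1 + (4 / (1 + u ^ 2) * v) ^ 2) ^ (-(3 : ℝ) / 2) := by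
  have hA : 0 < 1 + u ^ 2 := by positivity
  simp only [profile]
  set A := 1 + u ^ 2
  have e : A ^ 2 + 16 * v ^ 2 = A ^ 2 * (1 + (4 / A * v) ^ 2) := by field_simp; ring
  have e2 : (A ^ 2) ^ (-(3 : ℝ) / 2) = (A ^ 3)⁻¹ := by
    rw [← Real.rpow_natCast, ← Real.rpow_mul hA.le, ← Real.rpow_natCast A 3, ← Real.rpow_neg hA.le]
    norm_num
  rw [e, Real.mul_rpow (by positivity) (by positivity), e2]
  field_simp

lemma integrable_profile_slice (u : ℝ) : Integrable fun v => profile (u, v) := by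
  simp only [profile_eq]
  exact (integrable_one_add_sq_rpow.comp_mul_left' (by positivity)).const_mul _

lemma integral_profile_slice (u : ℝ) : ∫ v, profile (u, v) = (1 / 2) * (1 + u ^ 2)⁻¹ := by
  have hA : 0 < 1 + u ^ 2 := by positivity
  simp only [profile_eq]
  rw [integral_const_mul,
    Measure.integral_comp_mul_left (fun v : ℝ => (1 + v ^ 2) ^ (-(3 : ℝ) / 2)),
    integral_one_add_sq_rpow, abs_of_pos (by positivity), smul_eq_mul]
  field_simp
  norm_num

lemma integrable_profile : Integrable profile := by
  have hm : Measurable profile := by unfold profile; fun_prop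
  refine (integrable_prod_iff hm.aestronglyMeasurable).mpr
    ⟨Eventually.of_forall integrable_profile_slice, ?_⟩
  simp only [Real.norm_eq_abs, abs_of_nonneg (profile_nonneg _), integral_profile_slice]
  exact integrable_inv_one_add_sq.const_mul _

lemma integral_profile : ∫ w, profile w = Real.pi / 2 := by
  rw [Measure.volume_eq_prod, integral_prod _ integrable_profile]
  simp only [integral_profile_slice]
  rw [integral_const_mul, integral_univ_inv_one_add_sq]
  ring

lemma integral_comp_diag {d₁ d₂ : ℝ} (h₁ : d₁ ≠ 0) (h₂ : d₂ ≠ 0) (F : ℝ × ℝ → ℝ) :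
    ∫ w : ℝ × ℝ, F (d₁ * w.1, d₂ * w.2) = |d₁⁻¹| * |d₂⁻¹| * ∫ w, F w := by
  have he : MeasurableEmbedding (Prod.map (d₁ * ·) (d₂ * ·) : ℝ × ℝ → ℝ × ℝ) :=
    (measurableEmbedding_mulLeft₀ h₁).prodMap (measurableEmbedding_mulLeft₀ h₂)
  have hm : Measure.map (Prod.map (d₁ * ·) (d₂ * ·)) (volume : Measure (ℝ × ℝ)) =
      ENNReal.ofReal (|d₁⁻¹| * |d₂⁻¹|) • volume := by
    rw [Measure.volume_eq_prod, ← Measure.map_prod_map _ _ (by fun_prop) (by fun_prop),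
      Real.map_volume_mul_left h₁, Real.map_volume_mul_left h₂, Measure.prod_smul_left,
      Measure.prod_smul_right, smul_smul, ENNReal.ofReal_mul (abs_nonneg _)]
  have h := he.integral_map (μ := volume) F
  rw [hm, integral_smul_measure, ENNReal.toReal_ofReal (by positivity), smul_eq_mul] at h
  exact h.symm

lemma k1_shear_scaled (c : ℝ) {x : ℝ × ℝ × ℝ} (hx : x.1 ≠ 0) (w : ℝ × ℝ) :
    k1 c x (shear x (|x.1| * w.1, x.1 ^ 2 * w.2)) =
      2 * c * (x.1 / |x.1|) * (|x.1| * x.1 ^ 2)⁻¹ * profile w := by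
  have hd : 0 < |x.1| := abs_pos.mpr hx
  rw [k1_shear, profile]
  have e : (x.1 ^ 2 + (|x.1| * w.1) ^ 2) ^ 2 + 16 * (x.1 ^ 2 * w.2) ^ 2 =
      |x.1| ^ 4 * ((1 + w.1 ^ 2) ^ 2 + 16 * w.2 ^ 2) := by
    rw [← sq_abs x.1]; ring
  have e2 : (|x.1| ^ 4) ^ (-(3 : ℝ) / 2) = (|x.1| ^ 6)⁻¹ := by
    rw [← Real.rpow_natCast, ← Real.rpow_mul hd.le, ← Real.rpow_natCast _ 6, ← Real.rpow_neg hd.le]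
    norm_num
  rw [e, Real.mul_rpow (by positivity) (by positivity), e2]
  simp only [mul_pow]
  rw [← sq_abs x.1]
  field_simp

lemma integral_k1_mul (c : ℝ) {g : ℝ × ℝ → ℝ} (hgc : Continuous g)
    {x : ℝ × ℝ × ℝ} (hx : x.1 ≠ 0) :
    ∫ y, k1 c x y * g y = 2 * c * (x.1 / |x.1|) *
      ∫ w : ℝ × ℝ, profile w * g (shear x (|x.1| * w.1, x.1 ^ 2 * w.2)) := by
  have hd : 0 < |x.1| := abs_pos.mpr hx
  have hcont : Continuous fun y => k1 c x y * g y := (continuous_k1 c hx).mul hgc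
  rw [← integral_comp_shear x hcont]
  have h := integral_comp_diag hd.ne' (pow_ne_zero 2 hx)
    (fun w => k1 c x (shear x w) * g (shear x w))
  simp only [k1_shear_scaled c hx, mul_assoc] at h
  simp only [integral_const_mul] at h
  have a1 : |(|x.1|)⁻¹| = |x.1|⁻¹ := abs_of_pos (inv_pos.mpr hd)
  have a2 : |(x.1 ^ 2)⁻¹| = (x.1 ^ 2)⁻¹ := abs_of_pos (by positivity)
  rw [a1, a2] at h
  have h3 : ∫ y, k1 c x (shear x y) * g (shear x y) = |x.1| * x.1 ^ 2 *
      (|x.1|⁻¹ * ((x.1 ^ 2)⁻¹ * ∫ y, k1 c x (shear x y) * g (shear x y))) := by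
    field_simp
  rw [h3, ← h]
  field_simp

lemma tendsto_integral_profile {g : ℝ × ℝ → ℝ} (hg : HasCompactSupport g) (hgc : Continuous g)
    (x0 : ℝ × ℝ) :
    Tendsto (fun x : ℝ × ℝ × ℝ =>
        ∫ w : ℝ × ℝ, profile w * g (shear x (|x.1| * w.1, x.1 ^ 2 * w.2)))
      (nhds ((0 : ℝ), x0.1, x0.2)) (nhds (Real.pi / 2 * g x0)) := by
  obtain ⟨M, hM⟩ := hg.exists_bound_of_continuous hgc
  rw [← integral_profile, ← integral_mul_const]
  have hm : Measurable profile := by unfold profile; fun_prop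
  refine tendsto_integral_filter_of_dominated_convergence (fun w => profile w * M) ?_ ?_
    (integrable_profile.mul_const M) ?_
  · refine Eventually.of_forall fun x => (hm.mul (hgc.measurable.comp ?_)).aestronglyMeasurable
    unfold shear; fun_prop
  · refine Eventually.of_forall fun x => Eventually.of_forall fun w => ?_
    rw [norm_mul, Real.norm_of_nonneg (profile_nonneg w)]
    exact mul_le_mul_of_nonneg_left (hM _) (profile_nonneg w)
  · refine Eventually.of_forall fun w => Tendsto.const_mul _ ?_
    have h : Continuous fun x : ℝ × ℝ × ℝ => g (shear x (|x.1| * w.1, x.1 ^ 2 * w.2)) := by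
      refine hgc.comp ?_
      unfold shear; fun_prop
    have h0 := h.tendsto ((0 : ℝ), x0.1, x0.2)
    simpa [shear] using h0

lemma tendsto_double_layer {c : ℝ} (hc : 0 ≤ c) {g : ℝ × ℝ → ℝ} (hg : HasCompactSupport g)
    {L : ℝ} (hLip : ∀ a b : ℝ × ℝ, |g a - g b| ≤ L * dt a b) (x0 : ℝ × ℝ)
    {s : Set (ℝ × ℝ × ℝ)} {σ : ℝ} (hs : ∀ x ∈ s, x.1 ≠ 0 ∧ x.1 / |x.1| = σ) :
    Tendsto (fun x : ℝ × ℝ × ℝ => ∫ y, (k1 c x y + kker c x y) * g y)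
      (nhdsWithin ((0 : ℝ), x0.1, x0.2) s)
      (nhds (2 * c * σ * (Real.pi / 2 * g x0) +
        ((∫ y in bhat 1 x0, kconv c (x0 - y) * (g y - g x0)) +
          ∫ y in (bhat 1 x0)ᶜ, kconv c (x0 - y) * g y))) := by
  have hgc := continuous_of_abs_sub_le_dt hLip
  rw [(kconv_integrals hc hg hLip x0).2.2]
  have h1 := ((tendsto_integral_profile hg hgc x0).mono_left
    (nhdsWithin_le_nhds (s := s))).const_mul (2 * c * σ)
  have h2 := (tendsto_integral_kker hc hg hLip x0).mono_left
    (nhdsWithin_mono _ (fun x hx => (hs x hx).1 : s ⊆ {x : ℝ × ℝ × ℝ | x.1 ≠ 0}))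
  refine (h1.add h2).congr' ?_
  filter_upwards [self_mem_nhdsWithin] with x hx
  obtain ⟨hx1, hx2⟩ := hs x hx
  have i1 : Integrable fun y => k1 c x y * g y :=
    ((continuous_k1 c hx1).mul hgc).integrable_of_hasCompactSupport hg.mul_left
  have i2 : Integrable fun y => kker c x y * g y :=
    ((continuous_kker c hx1).mul hgc).integrable_of_hasCompactSupport hg.mul_left
  simp only [add_mul]
  rw [integral_add i1 i2, integral_k1_mul c hgc hx1, hx2]

lemma X1d_eq {F : ℝ × ℝ × ℝ → ℝ} {x : ℝ × ℝ × ℝ} {d : ℝ} (hF : DifferentiableAt ℝ F x)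
    (h : HasDerivAt (fun t => F (x.1 + t, x.2.1, x.2.2 - t * (x.2.1 / 2))) d 0) :
    X1d F x = d := by
  have hl : HasDerivAt (fun t : ℝ => (x.1 + t, x.2.1, x.2.2 - t * (x.2.1 / 2)))
      ((1 : ℝ), (0 : ℝ), -(x.2.1 / 2)) 0 := by
    refine ((hasDerivAt_id (0 : ℝ)).const_add x.1).prodMk
      ((hasDerivAt_const (0 : ℝ) x.2.1).prodMk ?_)
    simpa using ((hasDerivAt_id (0 : ℝ)).mul_const (x.2.1 / 2)).const_sub x.2.2
  have hx : (x.1 + 0, x.2.1, x.2.2 - 0 * (x.2.1 / 2)) = x := by ext <;> simp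
  have hF' : HasFDerivAt F (fderiv ℝ F x) (x.1 + 0, x.2.1, x.2.2 - 0 * (x.2.1 / 2)) := by
    rw [hx]; exact hF.hasFDerivAt
  exact (hF'.comp_hasDerivAt (0 : ℝ) hl).unique h

lemma X2d_eq {F : ℝ × ℝ × ℝ → ℝ} {x : ℝ × ℝ × ℝ} {d : ℝ} (hF : DifferentiableAt ℝ F x)
    (h : HasDerivAt (fun t => F (x.1, x.2.1 + t, x.2.2 + t * (x.1 / 2))) d 0) :
    X2d F x = d := by
  have hl : HasDerivAt (fun t : ℝ => (x.1, x.2.1 + t, x.2.2 + t * (x.1 / 2)))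
      ((0 : ℝ), (1 : ℝ), x.1 / 2) 0 := by
    refine (hasDerivAt_const (0 : ℝ) x.1).prodMk
      (((hasDerivAt_id (0 : ℝ)).const_add x.2.1).prodMk ?_)
    simpa using ((hasDerivAt_id (0 : ℝ)).mul_const (x.1 / 2)).const_add x.2.2
  have hx : (x.1, x.2.1 + 0, x.2.2 + 0 * (x.1 / 2)) = x := by ext <;> simp
  have hF' : HasFDerivAt F (fderiv ℝ F x) (x.1, x.2.1 + 0, x.2.2 + 0 * (x.1 / 2)) := by
    rw [hx]; exact hF.hasFDerivAt
  exact (hF'.comp_hasDerivAt (0 : ℝ) hl).unique h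

/-- The fourth power of the Korányi gauge. -/
def gauge4 (x : ℝ × ℝ × ℝ) : ℝ := (x.1 ^ 2 + x.2.1 ^ 2) ^ 2 + 16 * x.2.2 ^ 2

lemma contDiff_gauge4 : ContDiff ℝ (⊤ : ℕ∞) gauge4 := by unfold gauge4; fun_prop

lemma X1d_comp_gauge4 {f : ℝ → ℝ} (hf : Differentiable ℝ f) :
    X1d (fun x => f (gauge4 x)) = fun x => deriv f (gauge4 x) *
      (4 * (x.1 ^ 2 + x.2.1 ^ 2) * x.1 - 16 * x.2.1 * x.2.2) := by
  ext x
  have hd : Differentiable ℝ gauge4 := contDiff_gauge4.differentiable (by simp)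
  refine X1d_eq (hf.comp hd x) ?_
  have h1 : HasDerivAt (fun t : ℝ => x.1 + t) 1 0 := (hasDerivAt_id (0 : ℝ)).const_add x.1
  have h3 : HasDerivAt (fun t : ℝ => x.2.2 - t * (x.2.1 / 2)) (-(x.2.1 / 2)) 0 := by
    simpa using ((hasDerivAt_id (0 : ℝ)).mul_const (x.2.1 / 2)).const_sub x.2.2
  have hs : HasDerivAt (fun t => gauge4 (x.1 + t, x.2.1, x.2.2 - t * (x.2.1 / 2)))
      (4 * (x.1 ^ 2 + x.2.1 ^ 2) * x.1 - 16 * x.2.1 * x.2.2) 0 := by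
    refine ((((h1.pow 2).add_const (x.2.1 ^ 2)).pow 2).add
      ((h3.pow 2).const_mul 16)).congr_deriv ?_
    simp; ring
  have hf' := (hf (gauge4 x)).hasDerivAt
  have hx : gauge4 (x.1 + 0, x.2.1, x.2.2 - 0 * (x.2.1 / 2)) = gauge4 x := by simp
  rw [← hx] at hf'
  have := hf'.comp (0 : ℝ) hs
  rw [hx] at this
  exact this

lemma X2d_comp_gauge4 {f : ℝ → ℝ} (hf : Differentiable ℝ f) :
    X2d (fun x => f (gauge4 x)) = fun x => deriv f (gauge4 x) *
      (4 * (x.1 ^ 2 + x.2.1 ^ 2) * x.2.1 + 16 * x.1 * x.2.2) := by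
  ext x
  have hd : Differentiable ℝ gauge4 := contDiff_gauge4.differentiable (by simp)
  refine X2d_eq (hf.comp hd x) ?_
  have h2 : HasDerivAt (fun t : ℝ => x.2.1 + t) 1 0 := (hasDerivAt_id (0 : ℝ)).const_add x.2.1
  have h3 : HasDerivAt (fun t : ℝ => x.2.2 + t * (x.1 / 2)) (x.1 / 2) 0 := by
    simpa using ((hasDerivAt_id (0 : ℝ)).mul_const (x.1 / 2)).const_add x.2.2
  have hs : HasDerivAt (fun t => gauge4 (x.1, x.2.1 + t, x.2.2 + t * (x.1 / 2)))
      (4 * (x.1 ^ 2 + x.2.1 ^ 2) * x.2.1 + 16 * x.1 * x.2.2) 0 := by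
    refine ((((h2.pow 2).const_add (x.1 ^ 2)).pow 2).add
      ((h3.pow 2).const_mul 16)).congr_deriv ?_
    simp; ring
  have hf' := (hf (gauge4 x)).hasDerivAt
  have hx : gauge4 (x.1, x.2.1 + 0, x.2.2 + 0 * (x.1 / 2)) = gauge4 x := by simp
  rw [← hx] at hf'
  have := hf'.comp (0 : ℝ) hs
  rw [hx] at this
  exact this

lemma X1d_mul {F G : ℝ × ℝ × ℝ → ℝ} {x : ℝ × ℝ × ℝ} (hF : DifferentiableAt ℝ F x)
    (hG : DifferentiableAt ℝ G x) :
    X1d (fun y => F y * G y) x = X1d F x * G x + F x * X1d G x := by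
  unfold X1d
  rw [fderiv_fun_mul hF hG]
  simp only [add_apply, smul_apply, smul_eq_mul]
  ring

lemma X2d_mul {F G : ℝ × ℝ × ℝ → ℝ} {x : ℝ × ℝ × ℝ} (hF : DifferentiableAt ℝ F x)
    (hG : DifferentiableAt ℝ G x) :
    X2d (fun y => F y * G y) x = X2d F x * G x + F x * X2d G x := by
  unfold X2d
  rw [fderiv_fun_mul hF hG]
  simp only [add_apply, smul_apply, smul_eq_mul]
  ring

/-- The radial profile of the sub-Laplacian of a function of the gauge. -/
def radialLap (f : ℝ → ℝ) (s : ℝ) : ℝ := 16 * s * deriv (deriv f) s + 24 * deriv f s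

lemma subLap_comp_gauge4 {f : ℝ → ℝ} (hf : ContDiff ℝ 2 f) (x : ℝ × ℝ × ℝ) :
    subLap (fun x => f (gauge4 x)) x =
      (x.1 ^ 2 + x.2.1 ^ 2) * radialLap f (gauge4 x) := by
  have hd : Differentiable ℝ gauge4 := contDiff_gauge4.differentiable (by simp)
  have hf1 : Differentiable ℝ f := hf.differentiable (by simp)
  have hf2 : Differentiable ℝ (deriv f) :=
    ((contDiff_succ_iff_deriv (n := 1)).mp hf).2.2.differentiable (by simp)
  have p1 : X1d (fun x => 4 * (x.1 ^ 2 + x.2.1 ^ 2) * x.1 - 16 * x.2.1 * x.2.2) x =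
      12 * x.1 ^ 2 + 12 * x.2.1 ^ 2 := by
    refine X1d_eq (by fun_prop) ?_
    have h1 : HasDerivAt (fun t : ℝ => x.1 + t) 1 0 := (hasDerivAt_id (0 : ℝ)).const_add x.1
    have h3 : HasDerivAt (fun t : ℝ => x.2.2 - t * (x.2.1 / 2)) (-(x.2.1 / 2)) 0 := by
      simpa using ((hasDerivAt_id (0 : ℝ)).mul_const (x.2.1 / 2)).const_sub x.2.2
    refine (((((h1.pow 2).add_const (x.2.1 ^ 2)).const_mul 4).mul h1).sub
      (h3.const_mul (16 * x.2.1))).congr_deriv ?_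
    simp; ring
  have p2 : X2d (fun x => 4 * (x.1 ^ 2 + x.2.1 ^ 2) * x.2.1 + 16 * x.1 * x.2.2) x =
      12 * x.1 ^ 2 + 12 * x.2.1 ^ 2 := by
    refine X2d_eq (by fun_prop) ?_
    have h2 : HasDerivAt (fun t : ℝ => x.2.1 + t) 1 0 := (hasDerivAt_id (0 : ℝ)).const_add x.2.1
    have h3 : HasDerivAt (fun t : ℝ => x.2.2 + t * (x.1 / 2)) (x.1 / 2) 0 := by
      simpa using ((hasDerivAt_id (0 : ℝ)).mul_const (x.1 / 2)).const_add x.2.2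
    refine (((((h2.pow 2).const_add (x.1 ^ 2)).const_mul 4).mul h2).add
      (h3.const_mul (16 * x.1))).congr_deriv ?_
    simp; ring
  have hfg : DifferentiableAt ℝ (fun y => deriv f (gauge4 y)) x := hf2.comp hd x
  rw [subLap, X1d_comp_gauge4 hf1, X2d_comp_gauge4 hf1,
    X1d_mul hfg (by fun_prop), X2d_mul hfg (by fun_prop),
    p1, p2, X1d_comp_gauge4 hf2, X2d_comp_gauge4 hf2]
  simp only [radialLap, gauge4]
  ring

lemma hasCompactSupport_comp_of_norm_le {E : Type*} [NormedAddCommGroup E] [ProperSpace E]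
    {s : E → ℝ} (hs : ∀ x, ‖x‖ ≤ 1 + s x) {h : ℝ → ℝ} (hh : HasCompactSupport h) :
    HasCompactSupport fun x => h (s x) := by
  obtain ⟨T, hT⟩ := hh.isBounded.exists_norm_le
  refine HasCompactSupport.of_support_subset_isCompact
    (isCompact_closedBall (0 : E) (1 + T)) fun x hx => ?_
  rw [mem_closedBall_zero_iff]
  have := (le_abs_self _).trans (hT (s x) (subset_tsupport h hx))
  linarith [hs x]

lemma abs_le_one_add_sq (a : ℝ) : |a| ≤ 1 + a ^ 2 := by
  rw [← sq_abs a]; nlinarith [sq_nonneg (|a| - 1), abs_nonneg a]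

lemma norm_le_one_add_gauge4 (x : ℝ × ℝ × ℝ) : ‖x‖ ≤ 1 + gauge4 x := by
  rw [Prod.norm_def, Prod.norm_def]
  simp only [Real.norm_eq_abs, max_le_iff, gauge4]
  have key : ∀ a : ℝ, |a| ≤ 1 + (a ^ 2) ^ 2 := fun a => by
    rw [← sq_abs a]
    nlinarith [sq_nonneg (|a| - 1), sq_nonneg (|a| ^ 2 - 1), abs_nonneg a]
  have h12 := mul_nonneg (sq_nonneg x.1) (sq_nonneg x.2.1)
  refine ⟨(key x.1).trans ?_, (key x.2.1).trans ?_, (abs_le_one_add_sq x.2.2).trans ?_⟩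
  · nlinarith [sq_nonneg (x.2.1 ^ 2), sq_nonneg x.2.2]
  · nlinarith [sq_nonneg (x.1 ^ 2), sq_nonneg x.2.2]
  · nlinarith [sq_nonneg (x.1 ^ 2 + x.2.1 ^ 2), sq_nonneg x.2.2]

lemma norm_le_one_add_sq_add_sq (x : ℝ × ℝ) : ‖x‖ ≤ 1 + (x.1 ^ 2 + x.2 ^ 2) := by
  rw [Prod.norm_def]
  simp only [Real.norm_eq_abs, max_le_iff]
  constructor
  · linarith [abs_le_one_add_sq x.1, sq_nonneg x.2]
  · linarith [abs_le_one_add_sq x.2, sq_nonneg x.1]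

lemma integral_comp_sq_add_sq (F : ℝ → ℝ) :
    ∫ z : ℝ × ℝ, F (z.1 ^ 2 + z.2 ^ 2) = Real.pi * ∫ p in Set.Ioi (0 : ℝ), F p := by
  rw [← integral_comp_polarCoord_symm, polarCoord_target]
  have e : ∀ p : ℝ × ℝ, p.1 • F ((polarCoord.symm p).1 ^ 2 + (polarCoord.symm p).2 ^ 2) =
      (p.1 * F (p.1 ^ 2)) * 1 := by
    intro p
    rw [polarCoord_symm_apply, smul_eq_mul, mul_one]
    congr 2
    linear_combination p.1 ^ 2 * Real.sin_sq_add_cos_sq p.2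
  simp only [e]
  rw [Measure.volume_eq_prod,
    setIntegral_prod_mul (fun r : ℝ => r * F (r ^ 2)) (fun _ : ℝ => (1 : ℝ)),
    ← integral_comp_rpow_Ioi F (p := 2) (by norm_num)]
  have e2 : ∀ r : ℝ, (|(2 : ℝ)| * r ^ ((2 : ℝ) - 1)) • F (r ^ (2 : ℝ)) =
      2 * (r * F (r ^ 2)) := by
    intro r
    norm_num
    ring
  simp only [e2]
  rw [integral_const_mul]
  simp
  rw [max_eq_left (by positivity)]
  ring

lemma contDiff_deriv_of_contDiff {f : ℝ → ℝ} (hf : ContDiff ℝ (⊤ : ℕ∞) f) :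
    ContDiff ℝ (⊤ : ℕ∞) (deriv f) :=
  (contDiff_infty_iff_deriv.mp hf).2

lemma continuous_radialLap {f : ℝ → ℝ} (hf : ContDiff ℝ (⊤ : ℕ∞) f) :
    Continuous (radialLap f) := by
  have h1 := (contDiff_deriv_of_contDiff hf).continuous
  have h2 := (contDiff_deriv_of_contDiff (contDiff_deriv_of_contDiff hf)).continuous
  unfold radialLap; fun_prop

lemma hasCompactSupport_radialLap {f : ℝ → ℝ} (hf : HasCompactSupport f) :
    HasCompactSupport (radialLap f) :=
  (hf.deriv.deriv.mul_left (f := fun s => 16 * s)).add (hf.deriv.mul_left (f := fun _ => 24))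

lemma integral_mul_radialLap_sq {f : ℝ → ℝ} (hf : ContDiff ℝ (⊤ : ℕ∞) f)
    (hc : HasCompactSupport f) :
    ∫ r in Set.Ioi (0 : ℝ), r * radialLap f (r ^ 2) = -4 * f 0 := by
  have hf1 := contDiff_deriv_of_contDiff hf
  set Φ : ℝ → ℝ := fun r => 8 * r ^ 2 * deriv f (r ^ 2) + 4 * f (r ^ 2) with hΦ
  have hn : ∀ r : ℝ, ‖r‖ ≤ 1 + r ^ 2 := abs_le_one_add_sq
  have hΦc : HasCompactSupport Φ :=
    ((hasCompactSupport_comp_of_norm_le hn hc.deriv).mul_left (f := fun r : ℝ => 8 * r ^ 2)).add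
      ((hasCompactSupport_comp_of_norm_le hn hc).mul_left (f := fun _ => 4))
  have hΦd : ContDiff ℝ 1 Φ := by
    have h1 : ContDiff ℝ 1 f := hf.of_le (by simp)
    have h2 : ContDiff ℝ 1 (deriv f) := hf1.of_le (by simp)
    rw [hΦ]; fun_prop
  have hd : deriv Φ = fun r => r * radialLap f (r ^ 2) := by
    ext r
    have e0 : HasDerivAt (fun r : ℝ => r ^ 2) (2 * r) r := by
      simpa using hasDerivAt_pow 2 r
    have e1 : HasDerivAt (fun r : ℝ => f (r ^ 2)) (deriv f (r ^ 2) * (2 * r)) r :=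
      HasDerivAt.comp r ((hf.differentiable (by simp)) _).hasDerivAt e0
    have e2 : HasDerivAt (fun r : ℝ => deriv f (r ^ 2)) (deriv (deriv f) (r ^ 2) * (2 * r)) r :=
      HasDerivAt.comp r ((hf1.differentiable (by simp)) _).hasDerivAt e0
    refine (((e0.const_mul 8).mul e2).add (e1.const_mul 4)).deriv.trans ?_
    simp only [radialLap]; ring
  rw [← hd, hΦc.integral_Ioi_deriv_eq hΦd]
  simp [hΦ]

lemma integral_pos_part_cos :
    ∫ a in Set.Ioo (-Real.pi) Real.pi, (if 0 < Real.cos a then Real.cos a else 0) = 2 := by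
  have hpi := Real.pi_pos
  have e : Set.EqOn (fun a => if 0 < Real.cos a then Real.cos a else 0)
      ((Set.Ioc (-(Real.pi / 2)) (Real.pi / 2)).indicator Real.cos)
      (Set.Ioo (-Real.pi) Real.pi) := by
    intro a ha
    by_cases h : a ∈ Set.Ioo (-(Real.pi / 2)) (Real.pi / 2)
    · rw [Set.indicator_of_mem (Set.Ioo_subset_Ioc_self h)]
      exact if_pos (Real.cos_pos_of_mem_Ioo h)
    · have hcos : Real.cos a ≤ 0 := by
        rw [Set.mem_Ioo, not_and_or, not_lt, not_lt] at h
        rcases h with h | h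
        · rw [← Real.cos_neg]
          exact Real.cos_nonpos_of_pi_div_two_le_of_le (by linarith) (by linarith [ha.1])
        · exact Real.cos_nonpos_of_pi_div_two_le_of_le h (by linarith [ha.2])
      simp only [if_neg (not_lt.mpr hcos)]
      by_cases h' : a ∈ Set.Ioc (-(Real.pi / 2)) (Real.pi / 2)
      · have : a = Real.pi / 2 := by
          by_contra hne
          exact h ⟨h'.1, lt_of_le_of_ne h'.2 hne⟩
        rw [Set.indicator_of_mem h', this, Real.cos_pi_div_two]
      · rw [Set.indicator_of_notMem h']
  have hsub : Set.Ioc (-(Real.pi / 2)) (Real.pi / 2) ⊆ Set.Ioo (-Real.pi) Real.pi := fun a ha =>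
    ⟨by linarith [ha.1], by linarith [ha.2]⟩
  rw [setIntegral_congr_fun measurableSet_Ioo e, setIntegral_indicator measurableSet_Ioc,
    Set.inter_eq_right.mpr hsub,
    ← intervalIntegral.integral_of_le (by linarith), integral_cos]
  simp; norm_num

/-- The Korányi kernel times the radial profile, in the coordinates `(|z|², 4t)`. -/
def planar (h : ℝ → ℝ) (p q : ℝ) : ℝ :=
  (p ^ 2 + q ^ 2) ^ (-(1 : ℝ) / 2) * (p * h (p ^ 2 + q ^ 2))

lemma abs_planar_le (h : ℝ → ℝ) (p q : ℝ) : |planar h p q| ≤ |h (p ^ 2 + q ^ 2)| := by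
  have hs : (p ^ 2 + q ^ 2) ^ (-(1 : ℝ) / 2) * |p| ≤ 1 := by
    rcases eq_or_ne p 0 with rfl | hp
    · simp
    have hp' : 0 < |p| := abs_pos.mpr hp
    have : (p ^ 2 + q ^ 2) ^ (-(1 : ℝ) / 2) ≤ |p|⁻¹ := by
      refine (Real.rpow_le_rpow_of_nonpos (x := |p| ^ 2) (by positivity) ?_ (by norm_num)).trans_eq ?_
      · rw [sq_abs]; nlinarith [sq_nonneg q]
      · rw [← Real.rpow_natCast, ← Real.rpow_mul hp'.le, ← Real.rpow_neg_one]; norm_num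
    calc _ ≤ |p|⁻¹ * |p| := by gcongr
      _ = 1 := inv_mul_cancel₀ hp'.ne'
  have h0 : 0 ≤ (p ^ 2 + q ^ 2) ^ (-(1 : ℝ) / 2) := by positivity
  rw [planar, abs_mul, abs_mul, abs_of_nonneg h0, ← mul_assoc]
  exact mul_le_of_le_one_left (abs_nonneg _) hs

lemma integral_planar {h : ℝ → ℝ} (hc : Continuous h) (hs : HasCompactSupport h) :
    ∫ q, ∫ p in Set.Ioi (0 : ℝ), planar h p q =
      2 * ∫ r in Set.Ioi (0 : ℝ), r * h (r ^ 2) := by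
  set F : ℝ × ℝ → ℝ := fun w => (Set.Ioi (0 : ℝ)).indicator (fun p => planar h p w.2) w.1 with hF
  have hFeq : F = {w : ℝ × ℝ | 0 < w.1}.indicator (fun w => planar h w.1 w.2) := by
    ext w
    by_cases hw : 0 < w.1
    · rw [hF, Set.indicator_of_mem (show w ∈ {w : ℝ × ℝ | 0 < w.1} from hw)]
      exact Set.indicator_of_mem (s := Set.Ioi (0 : ℝ)) hw _
    · rw [hF, Set.indicator_of_notMem (show w ∉ {w : ℝ × ℝ | 0 < w.1} from hw)]
      exact Set.indicator_of_notMem (s := Set.Ioi (0 : ℝ)) hw _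
  have hFm : Measurable F := by
    rw [hFeq]
    refine Measurable.indicator ?_ (measurableSet_lt (by fun_prop) (by fun_prop))
    have := hc.measurable
    unfold planar; fun_prop
  have hFi : Integrable F := by
    have hi : Integrable fun w : ℝ × ℝ => h (w.1 ^ 2 + w.2 ^ 2) :=
      (hc.comp (by fun_prop)).integrable_of_hasCompactSupport
        (hasCompactSupport_comp_of_norm_le norm_le_one_add_sq_add_sq hs)
    refine hi.norm.mono' hFm.aestronglyMeasurable (Eventually.of_forall fun w => ?_)
    exact (norm_indicator_le_norm_self (fun p => planar h p w.2) w.1).trans (abs_planar_le h _ _)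
  have h1 : ∫ w, F w = ∫ q, ∫ p in Set.Ioi (0 : ℝ), planar h p q := by
    rw [Measure.volume_eq_prod, integral_prod_symm _ hFi]
    congr 1
    ext q
    exact integral_indicator measurableSet_Ioi
  rw [← h1, ← integral_comp_polarCoord_symm, polarCoord_target]
  have e : Set.EqOn (fun p : ℝ × ℝ => p.1 • F (polarCoord.symm p))
      (fun p => (p.1 * h (p.1 ^ 2)) * (if 0 < Real.cos p.2 then Real.cos p.2 else 0))
      (Set.Ioi (0 : ℝ) ×ˢ Set.Ioo (-Real.pi) Real.pi) := by
    intro p hp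
    have hr : 0 < p.1 := hp.1
    have hsq : (p.1 * Real.cos p.2) ^ 2 + (p.1 * Real.sin p.2) ^ 2 = p.1 ^ 2 := by
      linear_combination p.1 ^ 2 * Real.sin_sq_add_cos_sq p.2
    simp only [polarCoord_symm_apply, smul_eq_mul, hF, Set.indicator_apply, Set.mem_Ioi,
      mul_pos_iff_of_pos_left hr]
    split_ifs with hcos
    · rw [planar, hsq, ← Real.rpow_natCast p.1 2, ← Real.rpow_mul hr.le]
      have : p.1 ^ (((2 : ℕ) : ℝ) * (-(1 : ℝ) / 2)) = p.1⁻¹ := by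
        rw [← Real.rpow_neg_one]; norm_num
      rw [this]
      field_simp
    · simp
  rw [setIntegral_congr_fun (measurableSet_Ioi.prod measurableSet_Ioo) e, Measure.volume_eq_prod,
    setIntegral_prod_mul (fun r : ℝ => r * h (r ^ 2))
      (fun a : ℝ => if 0 < Real.cos a then Real.cos a else 0), integral_pos_part_cos]
  ring

lemma gauge4_eq (x : ℝ × ℝ × ℝ) :
    gauge4 x = (x.1 ^ 2 + x.2.1 ^ 2) ^ 2 + (4 * x.2.2) ^ 2 := by
  unfold gauge4; ring

lemma integral_planar_gauge {h : ℝ → ℝ} (hc : Continuous h) (hs : HasCompactSupport h) :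
    ∫ x : ℝ × ℝ × ℝ, planar h (x.1 ^ 2 + x.2.1 ^ 2) (4 * x.2.2) =
      Real.pi / 2 * ∫ r in Set.Ioi (0 : ℝ), r * h (r ^ 2) := by
  have hm : Measurable fun x : ℝ × ℝ × ℝ => planar h (x.1 ^ 2 + x.2.1 ^ 2) (4 * x.2.2) := by
    have := hc.measurable
    unfold planar; fun_prop
  have hi : Integrable fun x : ℝ × ℝ × ℝ => planar h (x.1 ^ 2 + x.2.1 ^ 2) (4 * x.2.2) := by
    have hi : Integrable fun x : ℝ × ℝ × ℝ => h (gauge4 x) :=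
      (hc.comp contDiff_gauge4.continuous).integrable_of_hasCompactSupport
        (hasCompactSupport_comp_of_norm_le norm_le_one_add_gauge4 hs)
    refine hi.norm.mono' hm.aestronglyMeasurable (Eventually.of_forall fun x => ?_)
    rw [gauge4_eq]
    exact abs_planar_le h _ _
  have ha := volume_preserving_prodAssoc (α₁ := ℝ) (β₁ := ℝ) (γ₁ := ℝ)
  have hemb := (MeasurableEquiv.prodAssoc (α := ℝ) (β := ℝ) (γ := ℝ)).measurableEmbedding
  have hi' : Integrable (fun y : (ℝ × ℝ) × ℝ => planar h (y.1.1 ^ 2 + y.1.2 ^ 2) (4 * y.2))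
      (volume.prod volume) := ha.integrable_comp_of_integrable hi
  have hstep : ∫ x : ℝ × ℝ × ℝ, planar h (x.1 ^ 2 + x.2.1 ^ 2) (4 * x.2.2) =
      ∫ y : (ℝ × ℝ) × ℝ, planar h (y.1.1 ^ 2 + y.1.2 ^ 2) (4 * y.2) :=
    (ha.integral_comp hemb _).symm
  refine hstep.trans ((integral_prod_symm _ hi').trans ?_)
  have e : ∀ t : ℝ, ∫ z : ℝ × ℝ, planar h (z.1 ^ 2 + z.2 ^ 2) (4 * t) =
      Real.pi * ∫ p in Set.Ioi (0 : ℝ), planar h p (4 * t) := fun t =>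
    integral_comp_sq_add_sq fun p => planar h p (4 * t)
  refine (integral_congr_ae (Eventually.of_forall e)).trans ?_
  rw [integral_const_mul,
    Measure.integral_comp_mul_left (fun q => ∫ p in Set.Ioi (0 : ℝ), planar h p q),
    integral_planar hc hs]
  rw [abs_of_pos (by norm_num), smul_eq_mul]
  ring

lemma IsNormalizing.two_mul_mul_pi {c : ℝ} (hc : IsNormalizing c) : 2 * c * Real.pi = 1 := by
  let b : ContDiffBump (0 : ℝ) := ⟨1, 2, one_pos, one_lt_two⟩
  have hb : ContDiff ℝ (⊤ : ℕ∞) b := b.contDiff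
  have hb2 : ContDiff ℝ 2 b := b.contDiff
  have hbs : HasCompactSupport b := b.hasCompactSupport
  have hb0 : b 0 = 1 := b.one_of_mem_closedBall (by simp [b])
  have h := hc (fun x => b (gauge4 x)) (hb.comp contDiff_gauge4)
    (hasCompactSupport_comp_of_norm_le norm_le_one_add_gauge4 hbs)
  have e : ∀ y, Gam c 0 y * subLap (fun x => b (gauge4 x)) y =
      c * planar (radialLap b) (y.1 ^ 2 + y.2.1 ^ 2) (4 * y.2.2) := by
    intro y
    rw [subLap_comp_gauge4 hb2, gauge4_eq, planar, Gam]
    simp only [Prod.fst_zero, Prod.snd_zero]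
    have : ((0 - y.1) ^ 2 + (0 - y.2.1) ^ 2) ^ 2 +
        16 * (0 - y.2.2 - 1 / 2 * (y.1 * 0 - y.2.1 * 0)) ^ 2 =
        (y.1 ^ 2 + y.2.1 ^ 2) ^ 2 + (4 * y.2.2) ^ 2 := by ring
    rw [this]
    ring
  simp only [e] at h
  rw [integral_const_mul, integral_planar_gauge (continuous_radialLap hb)
    (hasCompactSupport_radialLap hbs), integral_mul_radialLap_sq hb hbs] at h
  have hg0 : gauge4 0 = 0 := by simp [gauge4]
  rw [hg0, hb0] at h
  linarith

/-- Jump relations for the double layer potential `D(g)` across the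
vertical plane `Π`: the boundary limits are `±(1/2) g + K(g)`, where both integrals
defining `K(g)` converge absolutely. -/
theorem stmt3 (c : ℝ) (hc : 0 < c) (hnorm : IsNormalizing c)
    (g : ℝ × ℝ → ℝ) (hg : HasCompactSupport g)
    (L : ℝ) (hLip : ∀ a b : ℝ × ℝ, |g a - g b| ≤ L * dt a b)
    (x0 : ℝ × ℝ) :
    IntegrableOn (fun y => kconv c (x0 - y) * (g y - g x0)) (bhat 1 x0) ∧
    IntegrableOn (fun y => kconv c (x0 - y) * g y) (bhat 1 x0)ᶜ ∧
    Tendsto (fun x : ℝ × ℝ × ℝ => ∫ y, (k1 c x y + kker c x y) * g y)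
      (nhdsWithin ((0 : ℝ), x0.1, x0.2) {x : ℝ × ℝ × ℝ | 0 < x.1})
      (nhds ((1 / 2) * g x0 +
        ((∫ y in bhat 1 x0, kconv c (x0 - y) * (g y - g x0)) +
          ∫ y in (bhat 1 x0)ᶜ, kconv c (x0 - y) * g y))) ∧
    Tendsto (fun x : ℝ × ℝ × ℝ => ∫ y, (k1 c x y + kker c x y) * g y)
      (nhdsWithin ((0 : ℝ), x0.1, x0.2) {x : ℝ × ℝ × ℝ | x.1 < 0})
      (nhds (-(1 / 2) * g x0 +
        ((∫ y in bhat 1 x0, kconv c (x0 - y) * (g y - g x0)) +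
          ∫ y in (bhat 1 x0)ᶜ, kconv c (x0 - y) * g y))) := by
  obtain ⟨hi1, hi2, -⟩ := kconv_integrals hc.le hg hLip x0
  have hpi := hnorm.two_mul_mul_pi
  refine ⟨hi1, hi2, ?_, ?_⟩
  · have h := tendsto_double_layer hc.le hg hLip x0 (s := {x : ℝ × ℝ × ℝ | 0 < x.1}) (σ := 1)
      fun x hx => by
        have hx' : 0 < x.1 := hx
        exact ⟨hx'.ne', by rw [abs_of_pos hx', div_self hx'.ne']⟩
    have e : 2 * c * 1 * (Real.pi / 2 * g x0) = 1 / 2 * g x0 := by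
      linear_combination (1 / 2 * g x0) * hpi
    rwa [e] at h
  · have h := tendsto_double_layer hc.le hg hLip x0 (s := {x : ℝ × ℝ × ℝ | x.1 < 0}) (σ := -1)
      fun x hx => by
        have hx' : x.1 < 0 := hx
        exact ⟨hx'.ne, by rw [abs_of_neg hx', div_neg, div_self hx'.ne]⟩
    have e : 2 * c * -1 * (Real.pi / 2 * g x0) = -(1 / 2) * g x0 := by
      linear_combination (-(1 / 2) * g x0) * hpi
    rwa [e] at h
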